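/- Let n ≥ 0 and r ≥ 2 be integers. Then |O_{1,r}(n)| = |D_{1,r}(n)| = E_{r,1}(n), i.e., the number of partitions of n with exactly one part size divisible by r equals the number of partitions of n in which exactly one part size appears at least r times, and both equal the excess of the total number of parts congruent to 1 mod r in all r-regular partitions of n over the total number of different part sizes in all partitions of n with no part repeated more than r−1 times. -/

import Mathlib

open scoped Classical

namespace BeckPaper

/-- The parts of a partition, sorted in non-increasing order. -/
def partsList {n : ℕ} (p : n.Partition) : List ℕ := p.parts.sort (· ≥ ·)

/-- The `i`-th part of a partition (`1`-indexed); `0` if `i` exceeds the number of parts. -/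
def part {n : ℕ} (p : n.Partition) (i : ℕ) : ℕ := (partsList p).getD (i - 1) 0

/-- `ℓ(λ)`: the number of parts of `λ`. -/
def numParts {n : ℕ} (p : n.Partition) : ℕ := Multiset.card p.parts

/-- `ℓ_t(λ)`: the number of parts of `λ` congruent to `t` modulo `r`. -/
def lMod (r t : ℕ) {n : ℕ} (p : n.Partition) : ℕ :=
  Multiset.card (p.parts.filter (fun x => x % r = t % r))

/-- `ℓ̄_t(λ)`: the number of different part sizes appearing at least `t` times in `λ`. -/
def lRep (t : ℕ) {n : ℕ} (p : n.Partition) : ℕ :=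
  (p.parts.toFinset.filter (fun s => t ≤ p.parts.count s)).card

/-- `ℓ̄(λ)`: the number of different part sizes of `λ`. -/
def lDist {n : ℕ} (p : n.Partition) : ℕ := p.parts.toFinset.card

/-- `d_t(λ)`: the number of indices `1 ≤ i ≤ ℓ(λ)` with `λ_i − λ_{i+1} ≥ t`. -/
def dCount (t : ℕ) {n : ℕ} (p : n.Partition) : ℕ :=
  ((Finset.Icc 1 (numParts p)).filter (fun i => t ≤ part p i - part p (i + 1))).card

/-- `λ ∈ O_r(n)`: no part is divisible by `r`. -/
def IsRegular (r : ℕ) {n : ℕ} (p : n.Partition) : Prop := ∀ x ∈ p.parts, ¬ r ∣ x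

/-- `λ ∈ D_r(n)`: no part appears more than `r − 1` times. -/
def IsRestricted (r : ℕ) {n : ℕ} (p : n.Partition) : Prop :=
  ∀ s : ℕ, p.parts.count s ≤ r - 1

/-- `λ ∈ F_r(n)`: all differences of consecutive parts (with `λ_{k+1} = 0`) are `≤ r − 1`. -/
def IsFlat (r : ℕ) {n : ℕ} (p : n.Partition) : Prop :=
  ∀ i, 1 ≤ i → i ≤ numParts p → part p i - part p (i + 1) ≤ r - 1

/-- `λ ∈ O_{1,r}(n)`: the set of part sizes divisible by `r` has exactly one element. -/
def IsOneRegular (r : ℕ) {n : ℕ} (p : n.Partition) : Prop :=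
  (p.parts.toFinset.filter (fun s => r ∣ s)).card = 1

/-- `λ ∈ D_{1,r}(n)`: exactly one part size appears at least `r` times. -/
def IsOneRestricted (r : ℕ) {n : ℕ} (p : n.Partition) : Prop :=
  (p.parts.toFinset.filter (fun s => r ≤ p.parts.count s)).card = 1

/-- `λ ∈ F_{1,r}(n)`: exactly one difference of consecutive parts is `≥ r`, and all
other such differences are `≤ r − 1`. -/
def IsOneFlat (r : ℕ) {n : ℕ} (p : n.Partition) : Prop :=
  ∃ i, (1 ≤ i ∧ i ≤ numParts p ∧ r ≤ part p i - part p (i + 1)) ∧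
    ∀ j, 1 ≤ j → j ≤ numParts p → j ≠ i → part p j - part p (j + 1) ≤ r - 1

/-- `λ ∈ T_r(n)`: exactly one part size has multiplicity at least `r`, and that
multiplicity is strictly less than `2r`. -/
def IsInT (r : ℕ) {n : ℕ} (p : n.Partition) : Prop :=
  ∃ s : ℕ, (r ≤ p.parts.count s ∧ p.parts.count s < 2 * r) ∧
    ∀ s' : ℕ, r ≤ p.parts.count s' → s' = s

/-- Number of partitions of `n` whose multiset of parts satisfies `P`. -/
noncomputable def NP (P : Multiset ℕ → Prop) (n : ℕ) : ℕ :=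
  ((Finset.univ : Finset n.Partition).filter (fun p => P p.parts)).card

theorem NP_shift (P Q : Multiset ℕ → Prop) (n s k : ℕ) (hs : 0 < s)
    (h1 : ∀ p, P p → k ≤ p.count s)
    (h2 : ∀ p, P (p + Multiset.replicate k s) ↔ Q p) :
    NP P n = if s * k ≤ n then NP Q (n - s * k) else 0 := by
  have hle : ∀ p : n.Partition, P p.parts → Multiset.replicate k s ≤ p.parts := fun p hp =>
    Multiset.le_count_iff_replicate_le.mp (h1 _ hp)
  have hsum : ∀ p : n.Partition, P p.parts → (p.parts - Multiset.replicate k s).sum + s * k = n := by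
    intro p hp
    have h := congrArg Multiset.sum (Multiset.sub_add_cancel (hle p hp))
    rw [Multiset.sum_add, Multiset.sum_replicate, p.parts_sum] at h
    simpa [mul_comm] using h
  split_ifs with hn
  · unfold NP
    refine Finset.card_bij'
      (i := fun p hp => ⟨p.parts - Multiset.replicate k s, ?_, ?_⟩)
      (j := fun p hp => ⟨p.parts + Multiset.replicate k s, ?_, ?_⟩) ?_ ?_ ?_ ?_
    · intro i hi
      exact p.parts_pos (Multiset.mem_of_le (Multiset.sub_le_self _ _) hi)
    · have := hsum p (by simpa using hp)
      omega
    · intro i hi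
      rcases Multiset.mem_add.mp hi with h | h
      · exact p.parts_pos h
      · rw [Multiset.eq_of_mem_replicate h]; exact hs
    · rw [Multiset.sum_add, Multiset.sum_replicate, p.parts_sum, smul_eq_mul, mul_comm k s]
      omega
    · intro p hp
      simp only [Finset.mem_filter, Finset.mem_univ, true_and] at hp ⊢
      rw [← h2, Multiset.sub_add_cancel (hle p hp)]
      exact hp
    · intro p hp
      simp only [Finset.mem_filter, Finset.mem_univ, true_and] at hp ⊢
      rw [h2]; exact hp
    · intro p hp
      simp only [Finset.mem_filter, Finset.mem_univ, true_and] at hp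
      ext1
      exact Multiset.sub_add_cancel (hle p hp)
    · intro p hp
      ext1
      exact Multiset.add_sub_cancel_right
  · unfold NP
    rw [Finset.card_eq_zero, Finset.filter_eq_empty_iff]
    intro p _ hp
    have := hsum p hp
    omega

def Reg (r : ℕ) (p : Multiset ℕ) : Prop := ∀ x ∈ p, ¬ r ∣ x
def Res (r : ℕ) (p : Multiset ℕ) : Prop := ∀ x, p.count x < r

theorem glaisher (r n : ℕ) (hr : 0 < r) : NP (Reg r) n = NP (Res r) n := by
  have h := Nat.Partition.card_restricted_eq_card_countRestricted n hr
  unfold NP Reg Res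
  convert! h using 2
  · ext p; simp [Nat.Partition.restricted]
  · ext p
    simp only [Nat.Partition.countRestricted, Finset.mem_filter, Finset.mem_univ, true_and]
    constructor
    · intro h x _; exact h x
    · intro h x
      by_cases hx : x ∈ p.parts
      · exact h x hx
      · rw [Multiset.count_eq_zero_of_notMem hx]; exact hr

/-- shifted count -/
noncomputable def g (r n k : ℕ) : ℕ := if k ≤ n then NP (Res r) (n - k) else 0

/-- All sizes but `s` appear fewer than `r` times; `s` appears between `u` and `u+r-1` times. -/
def Bet (r s u : ℕ) (p : Multiset ℕ) : Prop :=
  (u ≤ p.count s ∧ p.count s < u + r) ∧ ∀ x, x ≠ s → p.count x < r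

theorem NP_Bet (r n s u : ℕ) (hs : 0 < s) : NP (Bet r s u) n = g r n (s * u) := by
  unfold g
  apply NP_shift _ _ _ _ _ hs
  · intro p hp; exact hp.1.1
  · intro p
    unfold Bet Res
    simp only [Multiset.count_add, Multiset.count_replicate]
    constructor
    · rintro ⟨⟨_, h1⟩, h2⟩ x
      by_cases hx : x = s
      · subst hx; simp at h1; omega
      · have := h2 x hx
        rw [if_neg (Ne.symm hx)] at this; omega
    · intro h
      refine ⟨⟨by simp, ?_⟩, ?_⟩
      · have := h s; simp; omega
      · intro x hx
        rw [if_neg (Ne.symm hx)]; exact h x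

theorem NP_RegGe (r n s u : ℕ) (hr : 0 < r) (hs : 0 < s) (hsr : ¬ r ∣ s) :
    NP (fun p => Reg r p ∧ u ≤ p.count s) n = g r n (s * u) := by
  unfold g
  rw [← glaisher r _ hr]
  apply NP_shift _ _ _ _ _ hs
  · intro p hp; exact hp.2
  · intro p
    unfold Reg
    constructor
    · rintro ⟨h, _⟩ x hx
      exact h x (Multiset.mem_add.mpr (Or.inl hx))
    · intro h
      refine ⟨?_, by simp⟩
      intro x hx
      rcases Multiset.mem_add.mp hx with h' | h'
      · exact h x h'
      · rw [Multiset.eq_of_mem_replicate h']; exact hsr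

/-- `r*s` appears exactly `m` times, no other multiple of `r` appears -/
def One (r s m : ℕ) (p : Multiset ℕ) : Prop :=
  p.count (r * s) = m ∧ ∀ x ∈ p, r ∣ x → x = r * s

theorem NP_One (r n s m : ℕ) (hr : 0 < r) (hs : 0 < s) :
    NP (One r s m) n = g r n (r * s * m) := by
  unfold g
  rw [← glaisher r _ hr]
  apply NP_shift _ _ _ _ _ (Nat.mul_pos hr hs)
  · intro p hp; exact hp.1.ge
  · intro p
    unfold Reg One
    constructor
    · rintro ⟨h1, h2⟩ x hx hd
      have := h2 x (Multiset.mem_add.mpr (Or.inl hx)) hd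
      subst this
      simp at h1
      exact h1 hx
    · intro h
      refine ⟨?_, ?_⟩
      · simp only [Multiset.count_add, Multiset.count_replicate_self, Nat.add_eq_right]
        apply Multiset.count_eq_zero_of_notMem
        intro hx
        exact h _ hx (Dvd.intro _ rfl)
      · intro x hx hd
        rcases Multiset.mem_add.mp hx with h' | h'
        · exact absurd hd (h x h')
        · exact Multiset.eq_of_mem_replicate h'

theorem NP_biUnion {ι : Type*} (I : Finset ι) (P : Multiset ℕ → Prop) (F : ι → Multiset ℕ → Prop)
    (n : ℕ) (h : ∀ p : n.Partition, P p.parts ↔ ∃ i ∈ I, F i p.parts)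
    (hd : ∀ p : n.Partition, ∀ i ∈ I, ∀ j ∈ I, F i p.parts → F j p.parts → i = j) :
    NP P n = ∑ i ∈ I, NP (F i) n := by
  unfold NP
  rw [← Finset.card_biUnion]
  · congr 1
    ext p
    simp [h]
  · intro i hi j hj hij
    refine Finset.disjoint_left.mpr ?_
    intro p hp hp'
    simp only [Finset.mem_filter, Finset.mem_univ, true_and] at hp hp'
    exact hij (hd p i hi j hj hp hp')

theorem count_mul_le {n : ℕ} (p : n.Partition) (s : ℕ) : p.parts.count s * s ≤ n := by
  have h : Multiset.replicate (p.parts.count s) s ≤ p.parts :=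
    Multiset.le_count_iff_replicate_le.mp le_rfl
  obtain ⟨q, hq⟩ := Multiset.le_iff_exists_add.mp h
  have := congrArg Multiset.sum hq
  rw [p.parts_sum, Multiset.sum_add, Multiset.sum_replicate, smul_eq_mul] at this
  omega

theorem count_le {n : ℕ} (p : n.Partition) (s : ℕ) : p.parts.count s ≤ n := by
  by_cases hs : s ∈ p.parts
  · have := p.parts_pos hs
    have := count_mul_le p s
    nlinarith
  · rw [Multiset.count_eq_zero_of_notMem hs]; omega

theorem mem_of_pos_count {n : ℕ} (p : n.Partition) (s : ℕ) (h : 0 < p.parts.count s) :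
    s ∈ Finset.Icc 1 n := by
  have hs := Multiset.count_pos.mp h
  rw [Finset.mem_Icc]
  exact ⟨p.parts_pos hs, Nat.Partition.le_of_mem_parts hs⟩

theorem oneReg_count (n r : ℕ) (hr : 0 < r) :
    NP (fun q => (q.toFinset.filter (fun s => r ∣ s)).card = 1) n =
      ∑ s ∈ Finset.Icc 1 n, ∑ m ∈ Finset.Icc 1 n, g r n (r * s * m) := by
  rw [← Finset.sum_product' (f := fun s m => g r n (r * s * m))]
  rw [NP_biUnion (Finset.Icc 1 n ×ˢ Finset.Icc 1 n) _ (fun i => One r i.1 i.2)]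
  · apply Finset.sum_congr rfl
    rintro ⟨s, m⟩ h
    simp only [Finset.mem_product, Finset.mem_Icc] at h
    exact NP_One r n s m hr (by omega)
  · intro p
    rw [Finset.card_eq_one]
    constructor
    · rintro ⟨a, ha⟩
      have ha' : a ∈ p.parts ∧ r ∣ a := by
        have : a ∈ ({a} : Finset ℕ) := by simp
        rw [← ha] at this; simpa using this
      obtain ⟨h1, s, rfl⟩ := ha'
      have hc := Multiset.count_pos.mpr h1
      have h3 := Finset.mem_Icc.mp (mem_of_pos_count p _ hc)
      have h4 := count_le p (r * s)
      refine ⟨(s, p.parts.count (r * s)), ?_, rfl, ?_⟩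
      · simp only [Finset.mem_product, Finset.mem_Icc]
        refine ⟨⟨?_, ?_⟩, by omega, by omega⟩
        · rcases Nat.eq_zero_or_pos s with h | h
          · subst h; omega
          · exact h
        · nlinarith
      · intro x hx hd
        have : x ∈ ({r * s} : Finset ℕ) := by
          rw [← ha]; simp [hx, hd]
        simpa using this
    · rintro ⟨⟨s, m⟩, hi, h1, h2⟩
      simp only [Finset.mem_product, Finset.mem_Icc] at hi h1 h2
      refine ⟨r * s, ?_⟩
      ext x
      simp only [Finset.mem_filter, Multiset.mem_toFinset, Finset.mem_singleton]
      constructor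
      · rintro ⟨hx, hd⟩; exact h2 x hx hd
      · rintro rfl
        exact ⟨Multiset.count_pos.mp (by omega), Dvd.intro _ rfl⟩
  · rintro p ⟨s, m⟩ hi ⟨s', m'⟩ hi' ⟨h1, h2⟩ ⟨h1', h2'⟩
    simp only [Finset.mem_product, Finset.mem_Icc] at hi hi' h1 h2 h1' h2'
    have := h2' (r * s) (Multiset.count_pos.mp (by omega)) (Dvd.intro _ rfl)
    have hss := Nat.eq_of_mul_eq_mul_left hr this
    subst hss
    rw [Prod.mk.injEq]; exact ⟨rfl, by omega⟩

theorem bet_mul_unique {r c m m' : ℕ} (h1 : r * m ≤ c) (h2 : c < r * m + r)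
    (h1' : r * m' ≤ c) (h2' : c < r * m' + r) : m = m' := by
  rcases lt_trichotomy m m' with h | h | h
  · nlinarith
  · exact h
  · nlinarith

theorem oneRes_count (n r : ℕ) (hr : 0 < r) :
    NP (fun q => (q.toFinset.filter (fun s => r ≤ q.count s)).card = 1) n =
      ∑ s ∈ Finset.Icc 1 n, ∑ m ∈ Finset.Icc 1 n, g r n (r * s * m) := by
  rw [← Finset.sum_product' (f := fun s m => g r n (r * s * m))]
  rw [NP_biUnion (Finset.Icc 1 n ×ˢ Finset.Icc 1 n) _ (fun i => Bet r i.1 (r * i.2))]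
  · apply Finset.sum_congr rfl
    rintro ⟨s, m⟩ h
    simp only [Finset.mem_product, Finset.mem_Icc] at h
    rw [NP_Bet r n s _ (by omega)]
    congr 1; ring
  · intro p
    rw [Finset.card_eq_one]
    constructor
    · rintro ⟨a, ha⟩
      have ha' : a ∈ p.parts ∧ r ≤ p.parts.count a := by
        have : a ∈ ({a} : Finset ℕ) := by simp
        rw [← ha] at this; simpa using this
      obtain ⟨h1, h2⟩ := ha'
      have hc := Multiset.count_pos.mpr h1
      have h3 := mem_of_pos_count p _ hc
      have h4 := count_le p a
      refine ⟨(a, p.parts.count a / r), ?_, ⟨?_, ?_⟩, ?_⟩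
      · rw [Finset.mem_product]
        refine ⟨h3, ?_⟩
        rw [Finset.mem_Icc]
        exact ⟨Nat.div_pos h2 hr, (Nat.div_le_self _ _).trans h4⟩
      · exact Nat.mul_div_le _ _
      · exact Nat.lt_mul_div_succ _ hr
      · intro x hx
        by_contra hcon
        push Not at hcon
        have : x ∈ ({a} : Finset ℕ) := by
          rw [← ha]
          simp only [Finset.mem_filter, Multiset.mem_toFinset]
          exact ⟨Multiset.count_pos.mp (by omega), hcon⟩
        exact hx (by simpa using this)
    · rintro ⟨⟨s, m⟩, hi, ⟨h1, h1'⟩, h2⟩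
      simp only [Finset.mem_product, Finset.mem_Icc] at hi h1 h2
      have : r ≤ r * m := Nat.le_mul_of_pos_right _ (by omega)
      refine ⟨s, ?_⟩
      ext x
      simp only [Finset.mem_filter, Multiset.mem_toFinset, Finset.mem_singleton]
      constructor
      · rintro ⟨hx, hd⟩
        by_contra hne
        have := h2 x hne
        omega
      · rintro rfl
        exact ⟨Multiset.count_pos.mp (by omega), by omega⟩
  · rintro p ⟨s, m⟩ hi ⟨s', m'⟩ hi' ⟨⟨h1, h3⟩, h2⟩ ⟨⟨h1', h3'⟩, h2'⟩
    simp only [Finset.mem_product, Finset.mem_Icc] at hi hi' h1 h2 h3 h1' h2' h3'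
    have : r ≤ r * m := Nat.le_mul_of_pos_right _ (by omega)
    have hss : s = s' := by
      by_contra hne
      have := h2' s hne
      omega
    subst hss
    rw [Prod.mk.injEq]; exact ⟨rfl, bet_mul_unique h1 h3 h1' h3'⟩

/-- `s` appears, and all other sizes appear fewer than `r` times. -/
def Big (r s : ℕ) (p : Multiset ℕ) : Prop := 1 ≤ p.count s ∧ ∀ x, x ≠ s → p.count x < r

theorem big1 (n r s : ℕ) (hr : 2 ≤ r) (hs : 0 < s) :
    NP (Big r s) n = ∑ u ∈ (Finset.Icc 1 n).filter (fun u => u % r = 1 % r), g r n (s * u) := by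
  have h1r : 1 % r = 1 := Nat.mod_eq_of_lt hr
  have key : ∀ u, u % r = 1 % r → u = r * (u / r) + 1 := by
    intro u hu
    have := Nat.div_add_mod u r
    omega
  rw [NP_biUnion ((Finset.Icc 1 n).filter (fun u => u % r = 1 % r)) _ (fun u => Bet r s u)]
  · exact Finset.sum_congr rfl fun u _ => NP_Bet r n s u hs
  · intro p
    constructor
    · rintro ⟨h1, h2⟩
      have h4 := count_le p s
      have h5 := Nat.mul_div_le (p.parts.count s - 1) r
      have h6 := Nat.lt_mul_div_succ (p.parts.count s - 1) (show 0 < r by omega)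
      rw [Nat.mul_add] at h6
      refine ⟨r * ((p.parts.count s - 1) / r) + 1, ?_, ⟨?_, ?_⟩, h2⟩
      · simp only [Finset.mem_filter, Finset.mem_Icc]
        refine ⟨⟨by omega, by omega⟩, ?_⟩
        simp
      · omega
      · omega
    · rintro ⟨u, hu, ⟨h1, _⟩, h2⟩
      simp only [Finset.mem_filter, Finset.mem_Icc] at hu
      exact ⟨by omega, h2⟩
  · rintro p u hu v hv ⟨⟨h1, h3⟩, h2⟩ ⟨⟨h1', h3'⟩, h2'⟩
    have e1 := key u (Finset.mem_filter.mp hu).2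
    have e2 := key v (Finset.mem_filter.mp hv).2
    have := bet_mul_unique (r := r) (c := p.parts.count s - 1) (m := u / r) (m' := v / r)
      (by omega) (by omega) (by omega) (by omega)
    rw [e1, e2, this]

theorem big2 (n r s : ℕ) (hr : 2 ≤ r) (hs : 0 < s) :
    NP (Big r s) n = NP (fun p => Res r p ∧ 1 ≤ p.count s) n
      + ∑ m ∈ Finset.Icc 1 n, g r n (r * s * m) := by
  have h0 : NP (Big r s) n = ∑ i ∈ (Finset.univ : Finset Bool),
      NP (fun p => if i then Res r p ∧ 1 ≤ p.count s else Big r s p ∧ r ≤ p.count s) n := by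
    apply NP_biUnion
    · intro p
      simp only [Finset.mem_univ, true_and, Bool.exists_bool, Res, Big, if_true, Bool.false_eq_true,
        if_false]
      constructor
      · rintro ⟨h1, h2⟩
        by_cases h : r ≤ p.parts.count s
        · exact Or.inl ⟨⟨h1, h2⟩, h⟩
        · right
          refine ⟨fun x => ?_, h1⟩
          by_cases hx : x = s
          · subst hx; omega
          · exact h2 x hx
      · rintro (h | h)
        · exact h.1
        · exact ⟨h.2, fun x _ => h.1 x⟩
    · intro p i _ j _
      cases i <;> cases j <;> simp [Res, Big] <;> intros
      all_goals first | grind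
  rw [h0, Fintype.sum_bool]
  simp only [if_true, Bool.false_eq_true, if_false]
  congr 1
  rw [NP_biUnion (Finset.Icc 1 n) _ (fun m => Bet r s (r * m))]
  · refine Finset.sum_congr rfl fun m _ => ?_
    rw [NP_Bet r n s _ hs]
    congr 1; ring
  · intro p
    constructor
    · rintro ⟨⟨h1, h2⟩, h3⟩
      have h4 := count_le p s
      refine ⟨p.parts.count s / r, ?_, ⟨Nat.mul_div_le _ _, Nat.lt_mul_div_succ _ (by omega)⟩, h2⟩
      rw [Finset.mem_Icc]
      exact ⟨Nat.div_pos h3 (by omega), (Nat.div_le_self _ _).trans h4⟩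
    · rintro ⟨m, hm, ⟨h1, _⟩, h2⟩
      rw [Finset.mem_Icc] at hm
      have : r ≤ r * m := Nat.le_mul_of_pos_right _ (by omega)
      exact ⟨⟨by omega, h2⟩, by omega⟩
  · rintro p u hu v hv ⟨⟨h1, h3⟩, h2⟩ ⟨⟨h1', h3'⟩, h2'⟩
    exact bet_mul_unique h1 h3 h1' h3'

theorem sum_lRep (n r : ℕ) (hr : 2 ≤ r) :
    ∑ p ∈ Finset.univ.filter (fun p : n.Partition => IsRestricted r p), lRep 1 p =
      ∑ s ∈ Finset.Icc 1 n, NP (fun p => Res r p ∧ 1 ≤ p.count s) n := by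
  have h : ∀ p : n.Partition, lRep 1 p = ∑ s ∈ Finset.Icc 1 n, if 1 ≤ p.parts.count s then 1 else 0 := by
    intro p
    rw [← Finset.card_filter]
    unfold lRep
    congr 1
    ext x
    simp only [Finset.mem_filter, Multiset.mem_toFinset]
    constructor
    · rintro ⟨_, h⟩; exact ⟨mem_of_pos_count p x h, h⟩
    · rintro ⟨_, h⟩; exact ⟨Multiset.count_pos.mp h, h⟩
  simp_rw [h]
  rw [Finset.sum_comm]
  refine Finset.sum_congr rfl fun s _ => ?_
  rw [← Finset.card_filter, Finset.filter_filter]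
  unfold NP
  congr 1
  ext p
  refine (@Finset.mem_filter _ _ (_) _ _).trans (Iff.trans ?_ (@Finset.mem_filter _ _ (_) _ _).symm)
  refine and_congr_right fun _ => ?_
  unfold IsRestricted Res
  refine and_congr_left fun _ => forall_congr' fun x => ?_
  omega

theorem sum_lMod (n r : ℕ) (hr : 2 ≤ r) :
    ∑ p ∈ Finset.univ.filter (fun p : n.Partition => IsRegular r p), lMod r 1 p =
      ∑ s ∈ (Finset.Icc 1 n).filter (fun u => u % r = 1 % r), ∑ m ∈ Finset.Icc 1 n,
        g r n (s * m) := by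
  have h : ∀ p : n.Partition, lMod r 1 p = ∑ s ∈ (Finset.Icc 1 n).filter (fun u => u % r = 1 % r),
      ∑ m ∈ Finset.Icc 1 n, if m ≤ p.parts.count s then 1 else 0 := by
    intro p
    unfold lMod
    rw [← Multiset.sum_count_eq_card (s := (Finset.Icc 1 n).filter (fun u => u % r = 1 % r))]
    · refine Finset.sum_congr rfl fun s hs => ?_
      rw [Multiset.count_filter, if_pos (Finset.mem_filter.mp hs).2, ← Finset.card_filter]
      have : (Finset.Icc 1 n).filter (fun m => m ≤ p.parts.count s)
          = Finset.Icc 1 (p.parts.count s) := by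
        ext m
        have := count_le p s
        simp only [Finset.mem_filter, Finset.mem_Icc]
        omega
      rw [this]; simp
    · intro a ha
      rw [Multiset.mem_filter] at ha
      rw [Finset.mem_filter]
      exact ⟨mem_of_pos_count p a (Multiset.count_pos.mpr ha.1), ha.2⟩
  simp_rw [h]
  rw [Finset.sum_comm]
  refine Finset.sum_congr rfl fun s hs => ?_
  rw [Finset.sum_comm]
  refine Finset.sum_congr rfl fun m _ => ?_
  rw [Finset.mem_filter, Finset.mem_Icc, Nat.mod_eq_of_lt (show 1 < r by omega)] at hs
  rw [← NP_RegGe r n s m (by omega) (by omega) (by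
    intro hd
    have := Nat.mod_eq_zero_of_dvd hd
    omega)]
  rw [← Finset.card_filter, Finset.filter_filter]
  unfold NP
  congr 1
  ext p
  refine (@Finset.mem_filter _ _ (_) _ _).trans (Iff.trans ?_ (@Finset.mem_filter _ _ (_) _ _).symm)
  rfl

theorem fu_tang (n r : ℕ) (hr : 2 ≤ r) :
    (Finset.univ.filter (fun p : n.Partition => IsOneRegular r p)).card = (Finset.univ.filter (fun p : n.Partition => IsOneRestricted r p)).card ∧
    ((Finset.univ.filter (fun p : n.Partition => IsOneRegular r p)).card : ℤ) =
      (∑ p ∈ Finset.univ.filter (fun p : n.Partition => IsRegular r p), (lMod r 1 p : ℤ)) -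
      ∑ p ∈ Finset.univ.filter (fun p : n.Partition => IsRestricted r p), (lRep 1 p : ℤ) := by
  have e1 : (Finset.univ.filter (fun p : n.Partition => IsOneRegular r p)).card =
      ∑ s ∈ Finset.Icc 1 n, ∑ m ∈ Finset.Icc 1 n, g r n (r * s * m) :=
    oneReg_count n r (by omega)
  have e2 : (Finset.univ.filter (fun p : n.Partition => IsOneRestricted r p)).card =
      ∑ s ∈ Finset.Icc 1 n, ∑ m ∈ Finset.Icc 1 n, g r n (r * s * m) :=
    oneRes_count n r (by omega)
  refine ⟨e1.trans e2.symm, ?_⟩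
  rw [e1, ← Nat.cast_sum, ← Nat.cast_sum, sum_lMod n r hr, sum_lRep n r hr, eq_sub_iff_add_eq]
  norm_cast
  rw [add_comm, ← Finset.sum_add_distrib, Finset.sum_comm (s := Finset.filter _ _)]
  refine Finset.sum_congr rfl fun s hs => ?_
  have hs' : 0 < s := (Finset.mem_Icc.mp hs).1
  rw [← big2 n r s hr hs', big1 n r s hr hs']
  exact Finset.sum_congr rfl fun u _ => by rw [mul_comm]

end BeckPaper
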